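/- Let h ∈ C²([0,1]) attain a global minimum m < 0 at a single interior point x̄ with h''(x̄) > 0, let λ < 0, b > 1/2, and set τ* = 1/(λm) > 0. Then for δ > 0 small, the ratio of ∫_{x̄−δ}^{x̄+δ} (1 − λτ h(x))^{-b} dx to C₂ (1 − λτ m)^{1/2−b} tends to 1 as τ ↗ τ*, where C₂ = (Γ(b−1/2)/Γ(b))·√(|m|π / (h''(x̄)/2)). -/

import Mathlib

open Real Filter

section Aux
open MeasureTheory

lemma J (b : ℝ) (hb : 1/2 < b) : ∫ u : ℝ, (1+u^2)^(-b) = √π * Gamma (b-1/2) / Gamma b := by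
  have hb0 : 0 < b := by linarith
  have hG := Gamma_pos_of_pos hb0
  rw [eq_div_iff hG.ne', mul_comm, ← integral_const_mul]
  have e1 : ∀ u : ℝ, Gamma b * (1+u^2)^(-b) = ∫ t in Set.Ioi (0:ℝ), t^(b-1) * exp (-((1+u^2)*t)) := by
    intro u
    have hp : 0 < 1+u^2 := by positivity
    rw [Real.integral_rpow_mul_exp_neg_mul_Ioi hb0 hp, one_div, inv_rpow hp.le, rpow_neg hp.le]
    ring
  have e2 : ∀ t ∈ Set.Ioi (0:ℝ), ∫ u : ℝ, t^(b-1) * exp (-((1+u^2)*t)) = √π * (exp (-t) * t^((b-1/2)-1)) := by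
    intro t ht
    have ht : 0 < t := ht
    have : ∀ u : ℝ, t^(b-1) * exp (-((1+u^2)*t)) = (t^(b-1) * exp (-t)) * exp (-t*u^2) := by
      intro u
      rw [mul_assoc, ← exp_add]; ring_nf
    simp_rw [this]
    rw [integral_const_mul, integral_gaussian, sqrt_div pi_pos.le, sqrt_eq_rpow t,
      show b - 1/2-1 = (b-1) - 1/2 by ring, rpow_sub ht (b-1)]
    ring
  simp_rw [e1]
  have hGi : IntegrableOn (fun t => √π * (exp (-t) * t^((b-1/2)-1))) (Set.Ioi 0) :=
    (Real.GammaIntegral_convergent (s := b-1/2) (by linarith)).const_mul _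
  rw [integral_integral_swap]
  · rw [setIntegral_congr_fun measurableSet_Ioi e2, integral_const_mul,
      Real.Gamma_eq_integral (by linarith)]
  · rw [integrable_prod_iff']
    · constructor
      · filter_upwards [ae_restrict_mem measurableSet_Ioi] with t ht
        have : ∀ u : ℝ, t^(b-1) * exp (-((1+u^2)*t)) = (t^(b-1) * exp (-t)) * exp (-t*u^2) := by
          intro u
          rw [mul_assoc, ← exp_add]; ring_nf
        simp only [Function.uncurry, this]
        exact (integrable_exp_neg_mul_sq ht).const_mul _
      · refine IntegrableOn.congr_fun hGi ?_ measurableSet_Ioi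
        intro t ht
        have ht' : 0 < t := ht
        beta_reduce
        rw [← e2 t ht]
        refine integral_congr_ae (Eventually.of_forall fun u => ?_)
        simp only [Function.uncurry]
        rw [norm_of_nonneg (by positivity)]
    · refine Measurable.aestronglyMeasurable ?_
      simp only [Function.uncurry_def]
      fun_prop

lemma Jint (b : ℝ) (hb : 1/2 < b) : Integrable (fun u : ℝ => (1+u^2)^(-b)) := by
  have := integrable_rpow_neg_one_add_norm_sq (E := ℝ) (r := 2*b) (μ := volume) (by simp; linarith)
  refine this.congr (Eventually.of_forall fun u => ?_)
  simp only [norm_eq_abs, sq_abs]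
  congr 1; ring

lemma Jscale (b a : ℝ) (hb : 1/2 < b) (ha : 0 < a) :
    Integrable (fun u : ℝ => (1+a*u^2)^(-b)) ∧
    ∫ u : ℝ, (1+a*u^2)^(-b) = √(1/a) * (√π * Gamma (b-1/2) / Gamma b) := by
  have hs : 0 < √a := sqrt_pos.2 ha
  have e : ∀ u : ℝ, (1+a*u^2)^(-b) = (fun v : ℝ => (1+v^2)^(-b)) (√a * u) := by
    intro u; simp only [mul_pow, sq_sqrt ha.le]
  simp_rw [e]
  refine ⟨(Jint b hb).comp_mul_left' hs.ne', ?_⟩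
  rw [Measure.integral_comp_mul_left (fun v : ℝ => (1+v^2)^(-b)) (√a), J b hb, abs_of_pos (by positivity), smul_eq_mul]
  simp

lemma Glim (h h' h'' : ℝ → ℝ) (m xbar : ℝ)
    (hd1 : ∀ x ∈ Set.Icc (0:ℝ) 1, HasDerivAt h (h' x) x)
    (hd2 : ∀ x ∈ Set.Icc (0:ℝ) 1, HasDerivAt h' (h'' x) x)
    (hx : xbar ∈ Set.Ioo (0:ℝ) 1)
    (hmval : h xbar = m) 
    (hmin : ∀ x ∈ Set.Icc (0:ℝ) 1, m ≤ h x) :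
    Tendsto (fun y => (h (xbar + y) - m) / y^2) (nhdsWithin 0 {0}ᶜ) (nhds (h'' xbar / 2)) := by
  have hxI : xbar ∈ Set.Icc (0:ℝ) 1 := Set.Ioo_subset_Icc_self hx
  have hnear : ∀ᶠ y : ℝ in nhds 0, xbar + y ∈ Set.Icc (0:ℝ) 1 := by
    have : Tendsto (fun y : ℝ => xbar + y) (nhds 0) (nhds xbar) := by
      have : Continuous (fun y : ℝ => xbar + y) := by fun_prop
      simpa using this.tendsto 0
    exact this.eventually (Icc_mem_nhds hx.1 hx.2)
  have h0 : h' xbar = 0 := by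
    refine IsLocalMin.hasDerivAt_eq_zero ?_ (hd1 xbar hxI)
    filter_upwards [Icc_mem_nhds hx.1 hx.2] with x hx'
    rw [hmval]; exact hmin x hx'
  refine HasDerivAt.lhopital_zero_nhdsNE (f' := fun y => h' (xbar+y)) (g' := fun y => 2*y) ?_ ?_ ?_ ?_ ?_ ?_
  · filter_upwards [hnear.filter_mono nhdsWithin_le_nhds] with y hy
    exact ((hd1 _ hy).comp_const_add xbar y).sub_const m
  · refine Eventually.of_forall fun y => ?_
    simpa using hasDerivAt_pow 2 y
  · filter_upwards [self_mem_nhdsWithin] with y hy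
    simpa using hy
  · have : ContinuousAt (fun y => h (xbar + y) - m) 0 := by
      have := (((by simpa using hd1 xbar hxI : HasDerivAt h (h' (xbar+0)) (xbar+0))).comp_const_add xbar 0).sub_const m
      exact this.continuousAt
    have := this.tendsto
    simp only [add_zero, hmval, sub_self] at this
    exact this.mono_left nhdsWithin_le_nhds
  · have : Continuous (fun y : ℝ => y^2) := by fun_prop
    have := this.tendsto 0
    simp only [ne_eq, OfNat.ofNat_ne_zero, not_false_eq_true, zero_pow] at this
    exact this.mono_left nhdsWithin_le_nhds
  · have := (hasDerivAt_iff_tendsto_slope_zero.1 (hd2 xbar hxI)).div_const 2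
    refine this.congr' ?_
    filter_upwards [self_mem_nhdsWithin] with y hy
    have : y ≠ 0 := by simpa using hy
    simp only [h0, smul_eq_mul, sub_zero]
    field_simp

end Aux

/-- Lemma 2.1(i): if `h ∈ C²([0,1])` attains its global minimum `m < 0` only at the
interior point `x̄`, with `h''(x̄) > 0`, `λ < 0`, `b > 1/2`, and `τ* = 1/(λm)`, then for
all small `δ > 0` the ratio of `∫_{x̄-δ}^{x̄+δ}(1 - λτ h(x))^{-b} dx` to
`C₂ (1 - λτ m)^{1/2-b}` tends to `1` as `τ ↗ τ*`, where
`C₂ = (Γ(b-1/2)/Γ(b)) √(|m|π/(h''(x̄)/2))`. -/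
theorem stmt9 (h h' h'' : ℝ → ℝ) (lam b m xbar : ℝ)
    (hd1 : ∀ x ∈ Set.Icc (0:ℝ) 1, HasDerivAt h (h' x) x)
    (hd2 : ∀ x ∈ Set.Icc (0:ℝ) 1, HasDerivAt h' (h'' x) x)
    (hc2 : ContinuousOn h'' (Set.Icc (0:ℝ) 1))
    (hx : xbar ∈ Set.Ioo (0:ℝ) 1)
    (hmval : h xbar = m) (hm : m < 0)
    (hmin : ∀ x ∈ Set.Icc (0:ℝ) 1, m ≤ h x)
    (hunique : ∀ x ∈ Set.Icc (0:ℝ) 1, x ≠ xbar → m < h x)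
    (hh'' : 0 < h'' xbar)
    (hlam : lam < 0) (hb : 1 / 2 < b) :
    ∃ δ₀ > 0, ∀ δ ∈ Set.Ioo (0:ℝ) δ₀,
      Tendsto (fun τ : ℝ =>
          (∫ x in xbar - δ..xbar + δ, (1 - lam * τ * h x) ^ (-b))
            / ((Real.Gamma (b - 1 / 2) / Real.Gamma b)
                * Real.sqrt (|m| * π / (h'' xbar / 2))
                * (1 - lam * τ * m) ^ (1 / 2 - b)))
        (nhdsWithin (1 / (lam * m)) (Set.Iio (1 / (lam * m)))) (nhds 1) := by
  have hxI : xbar ∈ Set.Icc (0:ℝ) 1 := Set.Ioo_subset_Icc_self hx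
  have hG := Glim h h' h'' m xbar hd1 hd2 hx hmval hmin
  set C := h'' xbar / 2 with hC
  have hCpos : 0 < C := by positivity
  obtain ⟨r, hr, hrG⟩ : ∃ r > 0, ∀ y : ℝ, |y| < r → C / 2 * y^2 ≤ h (xbar + y) - m := by
    have h1 : ∀ᶠ y in nhdsWithin (0:ℝ) {0}ᶜ, C / 2 < (h (xbar + y) - m) / y^2 :=
      hG.eventually (lt_mem_nhds (by linarith))
    rw [eventually_nhdsWithin_iff, Metric.eventually_nhds_iff] at h1
    obtain ⟨r, hr, h1⟩ := h1
    refine ⟨r, hr, fun y hy => ?_⟩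
    by_cases hy0 : y = 0
    · simp [hy0, hmval]
    · have := h1 (y := y) (by simpa using hy) (by simpa using hy0)
      rw [lt_div_iff₀ (by positivity)] at this
      exact this.le
  refine ⟨min r (min xbar (1 - xbar)), lt_min hr (lt_min hx.1 (by linarith [hx.2])), ?_⟩
  rintro δ ⟨hδ, hδ'⟩
  have hδr : δ < r := hδ'.trans_le (min_le_left _ _)
  have hδx : δ < xbar := hδ'.trans_le ((min_le_right _ _).trans (min_le_left _ _))
  have hδx' : δ < 1 - xbar := hδ'.trans_le ((min_le_right _ _).trans (min_le_right _ _))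
  have hlm : 0 < lam * m := mul_pos_of_neg_of_neg hlam hm
  set T := 1 / (lam * m) with hT
  have hTpos : 0 < T := by positivity
  have hTlm : lam * T * m = 1 := by rw [hT, show lam * (1 / (lam * m)) * m = (lam * m) / (lam * m) by ring, div_self hlm.ne']
  set l := nhdsWithin T (Set.Iio T) with hl
  have hle : l ≤ nhds T := nhdsWithin_le_nhds
  -- facts about eta
  have hηpos : ∀ᶠ τ in l, 0 < 1 - lam * τ * m := by
    filter_upwards [self_mem_nhdsWithin] with τ hτ
    have hτ : τ < T := hτ
    nlinarith
  have hη0 : Tendsto (fun τ => 1 - lam * τ * m) l (nhds 0) := by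
    have hc : Continuous (fun τ : ℝ => 1 - lam * τ * m) := by fun_prop
    have := hc.tendsto T
    simp only [hTlm, sub_self] at this
    exact this.mono_left hle
  have hs0 : Tendsto (fun τ => √(1 - lam * τ * m)) l (nhds 0) := by
    simpa using hη0.sqrt
  have hK : Tendsto (fun τ => -(lam * τ)) l (nhds (1 / |m|)) := by
    have hc : Continuous (fun τ : ℝ => -(lam * τ)) := by fun_prop
    have := hc.tendsto T
    have e : -(lam * T) = 1 / |m| := by
      rw [abs_of_neg hm, eq_div_iff (by linarith)]; linarith
    rw [e] at this
    exact this.mono_left hle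
  have hmabs : 0 < |m| := abs_pos.2 hm.ne
  have hKbd : ∀ᶠ τ in l, 1 / (2 * |m|) < -(lam * τ) := by
    refine hK.eventually (lt_mem_nhds ?_)
    rw [div_lt_div_iff₀ (by positivity) hmabs]; linarith
  let P : ℝ → ℝ → ℝ := fun τ t =>
    1 + -(lam * τ) * ((h (xbar + √(1 - lam * τ * m) * t) - m) / (1 - lam * τ * m))
  let S : ℝ → Set ℝ := fun τ => Set.Ioc (-(δ / √(1 - lam * τ * m))) (δ / √(1 - lam * τ * m))
  let F : ℝ → ℝ → ℝ := fun τ => (S τ).indicator (fun t => (P τ t) ^ (-b))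
  have hSmem : ∀ τ, 0 < 1 - lam * τ * m → ∀ t ∈ S τ, |√(1 - lam * τ * m) * t| ≤ δ := by
    intro τ hτ t ht
    have hs : 0 < √(1 - lam * τ * m) := sqrt_pos.2 hτ
    have : |t| ≤ δ / √(1 - lam * τ * m) := abs_le.2 ⟨ht.1.le, ht.2⟩
    rw [abs_mul, abs_of_pos hs, mul_comm]
    rwa [le_div_iff₀ hs] at this
  have hIcc : ∀ y, |y| ≤ δ → xbar + y ∈ Set.Icc (0:ℝ) 1 := by
    intro y hy
    have := abs_le.1 hy
    constructor <;> linarith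
  have hPbd : ∀ τ, 0 < 1 - lam * τ * m → 1 / (2 * |m|) < -(lam * τ) → ∀ t ∈ S τ,
      1 + (1 / (2 * |m|) * (C / 2)) * t^2 ≤ P τ t := by
    intro τ hτ hk t ht
    have h1 := hrG _ ((hSmem τ hτ t ht).trans_lt hδr)
    rw [mul_pow, sq_sqrt hτ.le] at h1
    have h2 : C / 2 * t^2 ≤ (h (xbar + √(1 - lam * τ * m) * t) - m) / (1 - lam * τ * m) := by
      rw [le_div_iff₀ hτ]; linarith
    have h3 : 1 / (2 * |m|) * (C / 2 * t^2) ≤ -(lam * τ) *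
        ((h (xbar + √(1 - lam * τ * m) * t) - m) / (1 - lam * τ * m)) :=
      mul_le_mul hk.le h2 (by positivity) (le_trans (by positivity) hk.le)
    simp only [P]
    linarith
  have hPpos : ∀ τ, 0 < 1 - lam * τ * m → 1 / (2 * |m|) < -(lam * τ) → ∀ t ∈ S τ,
      0 < P τ t := fun τ hτ hk t ht => lt_of_lt_of_le (by positivity) (hPbd τ hτ hk t ht)
  have hint : ∀ᶠ τ in l, (∫ x in xbar - δ..xbar + δ, (1 - lam * τ * h x) ^ (-b))
      = (1 - lam * τ * m) ^ (1 / 2 - b) * ∫ t, F τ t := by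
    filter_upwards [hηpos, hKbd] with τ hτ hk
    have hs : 0 < √(1 - lam * τ * m) := sqrt_pos.2 hτ
    have hsub := intervalIntegral.mul_integral_comp_add_mul
      (a := -(δ / √(1 - lam * τ * m))) (b := δ / √(1 - lam * τ * m))
      (f := fun x => (1 - lam * τ * h x) ^ (-b)) (√(1 - lam * τ * m)) xbar
    have ea : xbar + √(1 - lam * τ * m) * -(δ / √(1 - lam * τ * m)) = xbar - δ := by
      field_simp; ring
    have eb : xbar + √(1 - lam * τ * m) * (δ / √(1 - lam * τ * m)) = xbar + δ := by
      field_simp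
    rw [ea, eb] at hsub
    rw [← hsub, intervalIntegral.integral_of_le (by
      have : 0 < δ / √(1 - lam * τ * m) := by positivity
      linarith)]
    have hF : ∫ t, F τ t = ∫ t in S τ, (P τ t) ^ (-b) :=
      MeasureTheory.integral_indicator measurableSet_Ioc
    have hcongr : ∫ t in S τ, (1 - lam * τ * h (xbar + √(1 - lam * τ * m) * t)) ^ (-b)
        = ∫ t in S τ, (1 - lam * τ * m) ^ (-b) * (P τ t) ^ (-b) := by
      refine MeasureTheory.setIntegral_congr_fun measurableSet_Ioc fun t ht => ?_
      beta_reduce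
      rw [← mul_rpow hτ.le (hPpos τ hτ hk t ht).le]
      congr 1
      simp only [P]
      field_simp
      ring
    have hcongr' := hcongr
    rw [MeasureTheory.integral_const_mul, ← hF] at hcongr'
    change √(1 - lam * τ * m) * ∫ t in S τ, (1 - lam * τ * h (xbar + √(1 - lam * τ * m) * t)) ^ (-b) = _
    rw [hcongr', ← mul_assoc, sub_eq_add_neg (1/2 : ℝ) b, rpow_add hτ, ← sqrt_eq_rpow]
  have ha1 : 0 < 1 / (2 * |m|) * (C / 2) := by positivity
  have ha2 : 0 < 1 / |m| * C := by positivity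
  have hDCT : Tendsto (fun τ => ∫ t, F τ t) l (nhds (∫ t, (1 + (1 / |m| * C) * t^2) ^ (-b))) := by
    refine MeasureTheory.tendsto_integral_filter_of_dominated_convergence
      (fun t => (1 + (1 / (2 * |m|) * (C / 2)) * t^2) ^ (-b)) ?_ ?_ (Jscale b _ hb ha1).1 ?_
    · filter_upwards [hηpos, hKbd] with τ hτ hk
      refine (aestronglyMeasurable_indicator_iff measurableSet_Ioc).2 ?_
      refine ContinuousOn.aestronglyMeasurable ?_ measurableSet_Ioc
      refine ContinuousOn.rpow_const ?_ fun t ht => Or.inl (hPpos τ hτ hk t ht).ne'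
      have hcont : ContinuousOn h (Set.Icc 0 1) := fun x hx =>
        (hd1 x hx).continuousAt.continuousWithinAt
      have hcomp : ContinuousOn (fun t => h (xbar + √(1 - lam * τ * m) * t)) (S τ) :=
        hcont.comp (by fun_prop) fun t ht => hIcc _ (hSmem τ hτ t ht)
      exact continuousOn_const.add (continuousOn_const.mul ((hcomp.sub continuousOn_const).div_const _))
    · filter_upwards [hηpos, hKbd] with τ hτ hk
      refine Eventually.of_forall fun t => ?_
      by_cases ht : t ∈ S τ
      · simp only [F, Set.indicator_of_mem ht]
        rw [norm_of_nonneg (rpow_nonneg (hPpos τ hτ hk t ht).le _)]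
        exact rpow_le_rpow_of_nonpos (by positivity) (hPbd τ hτ hk t ht) (by linarith)
      · simp only [F, Set.indicator_of_notMem ht, norm_zero]
        positivity
    · refine Eventually.of_forall fun t => ?_
      have hmem : ∀ᶠ τ in l, t ∈ S τ := by
        have h1 : Tendsto (fun τ => √(1 - lam * τ * m) * |t|) l (nhds 0) := by
          simpa using hs0.mul_const |t|
        filter_upwards [hηpos, h1.eventually (gt_mem_nhds hδ)] with τ hτ h2
        have hs : 0 < √(1 - lam * τ * m) := sqrt_pos.2 hτ
        have h3 : |t| < δ / √(1 - lam * τ * m) := by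
          rw [lt_div_iff₀ hs]; linarith
        exact ⟨(abs_lt.1 h3).1, (abs_lt.1 h3).2.le⟩
      have hq : Tendsto (fun τ => (h (xbar + √(1 - lam * τ * m) * t) - m) / (1 - lam * τ * m)) l
          (nhds (C * t^2)) := by
        by_cases ht : t = 0
        · simp [ht, hmval]
        · have h1 : Tendsto (fun τ => √(1 - lam * τ * m) * t) l (nhdsWithin 0 {0}ᶜ) := by
            refine tendsto_nhdsWithin_iff.2 ⟨by simpa using hs0.mul_const t, ?_⟩
            filter_upwards [hηpos] with τ hτ
            have hs : 0 < √(1 - lam * τ * m) := sqrt_pos.2 hτ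
            exact mul_ne_zero hs.ne' ht
          refine ((hG.comp h1).mul_const (t^2)).congr' ?_
          filter_upwards [hηpos] with τ hτ
          simp only [Function.comp, mul_pow, sq_sqrt hτ.le]
          field_simp
      have hP : Tendsto (fun τ => P τ t) l (nhds (1 + (1 / |m| * C) * t^2)) := by
        have := (hK.mul hq).const_add 1
        rwa [← mul_assoc] at this
      refine (hP.rpow_const (p := -b) (Or.inl (by positivity))).congr' ?_
      filter_upwards [hmem] with τ hτ
      simp only [F, Set.indicator_of_mem hτ]
  rw [(Jscale b _ hb ha2).2] at hDCT
  have hg1 : 0 < Gamma (b - 1/2) := Gamma_pos_of_pos (by linarith)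
  have hg2 : 0 < Gamma b := Gamma_pos_of_pos (by linarith)
  have hval : √(1 / (1 / |m| * C)) * (√π * Gamma (b - 1 / 2) / Gamma b)
      = Gamma (b - 1 / 2) / Gamma b * √(|m| * π / C) := by
    have : |m| * π / C = 1 / (1 / |m| * C) * π := by field_simp
    rw [this, sqrt_mul (by positivity)]
    ring
  rw [hval] at hDCT
  have hD : 0 < Gamma (b - 1 / 2) / Gamma b * √(|m| * π / C) := by positivity
  have hfin := hDCT.div_const (Gamma (b - 1 / 2) / Gamma b * √(|m| * π / C))
  rw [div_self hD.ne'] at hfin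
  refine hfin.congr' ?_
  filter_upwards [hint, hηpos] with τ h1 hτ
  have hp : 0 < (1 - lam * τ * m) ^ (1 / 2 - b) := rpow_pos_of_pos hτ _
  rw [h1, mul_comm (_ ^ _) (∫ t, F τ t), mul_div_mul_right _ _ hp.ne']
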